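/- Let (N,M₀) be a safe Petri net with unfolding U and B⊆2^P reachability-closed. For any two finite configurations C₁,C₂ of U with Mark(C₁)=Mark(C₂), C₁ is doomed if and only if C₂ is doomed (equivalently, C₁ is free iff C₂ is free); hence doomedness and freeness are properties of the reachable marking Mark(C) alone. -/

import Mathlib

/-- A net `N = (P,T,F)`: the flow relation is split into its
place-to-transition part `pt` and transition-to-place part `tp`. -/
structure Net (P T : Type) where
  pt : P → T → Prop
  tp : T → P → Prop

namespace Net

variable {P T : Type} (N : Net P T)

/-- Preset of a transition: `•t`. -/
def preT (t : T) : Set P := {p | N.pt p t}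
/-- Postset of a transition: `t•`. -/
def postT (t : T) : Set P := {p | N.tp t p}
/-- Preset of a place: `•p`. -/
def preP (p : P) : Set T := {t | N.tp t p}
/-- Postset of a place: `p•`. -/
def postP (p : P) : Set T := {t | N.pt p t}

/-- Transition `t` is enabled at marking `M` iff `•t ⊆ M`. -/
def enabled (M : Set P) (t : T) : Prop := N.preT t ⊆ M
/-- Firing `t` at `M` yields `(M \ •t) ∪ t•`. -/
def fire (M : Set P) (t : T) : Set P := (M \ N.preT t) ∪ N.postT t
/-- One firing step between markings. -/
def stepRel (M M' : Set P) : Prop := ∃ t : T, N.enabled M t ∧ M' = N.fire M t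
/-- Reachability between markings (finite firing sequences). -/
def reach (M M' : Set P) : Prop := Relation.ReflTransGen N.stepRel M M'

/-- `(N, M₀)` is safe. -/
def safe (M₀ : Set P) : Prop :=
  ∀ M : Set P, N.reach M₀ M → ∀ t : T, N.enabled M t → M ∩ N.postT t ⊆ N.preT t

/-- `FiringSeq M l M'`: the sequence `l` of transitions can fire from `M`, ending in `M'`. -/
inductive FiringSeq : Set P → List T → Set P → Prop
  | nil (M : Set P) : FiringSeq M [] M
  | cons {M : Set P} (t : T) {l : List T} {M' : Set P} :
      N.enabled M t → FiringSeq (N.fire M t) l M' → FiringSeq M (t :: l) M'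

/-- The underlying edge relation of the flow, on nodes `P ⊕ T`. -/
def edge : (P ⊕ T) → (P ⊕ T) → Prop
  | Sum.inl p, Sum.inr t => N.pt p t
  | Sum.inr t, Sum.inl p => N.tp t p
  | _, _ => False

/-- Causality: `x < y` via a nonempty directed path. -/
def ltN (x y : P ⊕ T) : Prop := Relation.TransGen N.edge x y
/-- `x ≤ y` iff `x < y` or `x = y`. -/
def leN (x y : P ⊕ T) : Prop := N.ltN x y ∨ x = y

/-- Direct conflict of transitions: `•u ∩ •v ≠ ∅`. -/
def dirConflict (u v : T) : Prop := (N.preT u ∩ N.preT v).Nonempty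
/-- Conflict of nodes `x # y`. -/
def conflict (x y : P ⊕ T) : Prop :=
  ∃ u v : T, u ≠ v ∧ N.leN (Sum.inr u) x ∧ N.leN (Sum.inr v) y ∧ N.dirConflict u v
/-- Concurrency of nodes. -/
def concurrent (x y : P ⊕ T) : Prop :=
  ¬ N.leN x y ∧ ¬ N.leN y x ∧ ¬ N.conflict x y
/-- A co-set: a set of pairwise concurrent places (conditions). -/
def coset (S : Set P) : Prop :=
  ∀ b ∈ S, ∀ b' ∈ S, b ≠ b' → N.concurrent (Sum.inl b) (Sum.inl b')

end Net

/-- An occurrence net `O = (B, E, F, c₀)`: conditions `B`, events `E`. -/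
structure OccNet (B E : Type) extends Net B E where
  c₀ : Set B
  lt_irrefl : ∀ x : B ⊕ E, ¬ toNet.ltN x x
  pre_subsingleton : ∀ b : B, (toNet.preP b).Subsingleton
  mem_c₀_iff : ∀ b : B, b ∈ c₀ ↔ toNet.preP b = ∅
  no_self_conflict : ∀ e : E, ¬ toNet.conflict (Sum.inr e) (Sum.inr e)
  finite_past : ∀ e : E, {x : B ⊕ E | toNet.leN x (Sum.inr e)}.Finite

namespace OccNet

variable {B E : Type} (O : OccNet B E)

/-- A configuration: a causally closed, conflict-free set of events. -/
def config (C : Set E) : Prop :=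
  (∀ e ∈ C, ∀ e' : E, O.toNet.ltN (Sum.inr e') (Sum.inr e) → e' ∈ C) ∧
  (∀ e ∈ C, ∀ e' ∈ C, ¬ O.toNet.conflict (Sum.inr e) (Sum.inr e'))

/-- A run: a `⊆`-maximal configuration. -/
def run (ω : Set E) : Prop :=
  O.config ω ∧ ∀ C : Set E, O.config C → ω ⊆ C → C = ω

/-- `cut C = (c₀ ∪ C•) \ •C`. -/
def cut (C : Set E) : Set B :=
  (O.c₀ ∪ {b | ∃ e ∈ C, O.toNet.tp e b}) \ {b | ∃ e ∈ C, O.toNet.pt b e}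

/-- Event `e` is enabled by configuration `C`. -/
def enabledBy (C : Set E) (e : E) : Prop := e ∉ C ∧ O.config (C ∪ {e})

/-- `crest C`: the `<`-maximal events of `C`. -/
def crest (C : Set E) : Set E :=
  {e | e ∈ C ∧ ¬ ∃ e' ∈ C, O.toNet.ltN (Sum.inr e) (Sum.inr e')}

/-- The stump `⌊e⌋ = {e' : e' < e}` of an event. -/
def stump (e : E) : Set E := {e' | O.toNet.ltN (Sum.inr e') (Sum.inr e)}

/-- `spoiler e e'`: `e'` is a spoiler of `e`, i.e. `•e' ∩ •e ≠ ∅`. -/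
def spoiler (e e' : E) : Prop := (O.toNet.preT e' ∩ O.toNet.preT e).Nonempty

/-- An event is unchallenged iff no other event shares a precondition with it. -/
def unchallenged (e : E) : Prop :=
  ¬ ∃ e' : E, e' ≠ e ∧ (O.toNet.preT e' ∩ O.toNet.preT e).Nonempty

/-- A configuration is shaved iff its crest contains no unchallenged event. -/
def shaved (C : Set E) : Prop := ∀ e ∈ O.crest C, ¬ O.unchallenged e

/-- Strict `C`-conflict `e #^C e'`: `e ≠ e'`, `•e ∩ •e' ≠ ∅`, and `⌊e'⌋ ⊆ C`. -/
def strictConflict (C : Set E) (e e' : E) : Prop :=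
  e ≠ e' ∧ (O.toNet.preT e ∩ O.toNet.preT e').Nonempty ∧ O.stump e' ⊆ C

/-- Decisional height `δ(C)`: the number of events of `C` in strict `C`-conflict
with some event. -/
noncomputable def dHeight (C : Set E) : ℕ :=
  {e | e ∈ C ∧ ∃ e' : E, O.strictConflict C e e'}.ncard

end OccNet

/-- The unfolding `U = U(N, M₀)` of a Petri net `(N, M₀)`: an occurrence net with
conditions `B` and events `E`, together with the folding map (`fB` on conditions,
`fE` on events), satisfying the defining properties of the inductive construction:
the initial cut corresponds bijectively to `M₀`; the preset of an event `e` is a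
co-set folded bijectively onto `•f(e)` and its postset is folded bijectively onto
`f(e)•`; events are uniquely determined by (preset, label) and exist for every
co-set folding onto some `•t`; conditions are uniquely determined by
(producing event, label). -/
structure Unfolding (P T : Type) (N : Net P T) (M₀ : Set P) (B E : Type) where
  occ : OccNet B E
  fB : B → P
  fE : E → T
  init_bij : Set.BijOn fB occ.c₀ M₀
  pre_coset : ∀ e : E, occ.toNet.coset (occ.toNet.preT e)
  pre_bij : ∀ e : E, Set.BijOn fB (occ.toNet.preT e) (N.preT (fE e))
  post_bij : ∀ e : E, Set.BijOn fB (occ.toNet.postT e) (N.postT (fE e))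
  event_unique : ∀ e e' : E,
    occ.toNet.preT e = occ.toNet.preT e' → fE e = fE e' → e = e'
  event_exists : ∀ (S : Set B) (t : T), occ.toNet.coset S → Set.BijOn fB S (N.preT t) →
    ∃ e : E, occ.toNet.preT e = S ∧ fE e = t
  cond_unique : ∀ b b' : B,
    occ.toNet.preP b = occ.toNet.preP b' → fB b = fB b' → b = b'

/-- `Bad` is reachability-closed: `M ∈ Bad` and `M → M'` imply `M' ∈ Bad`. -/
def ReachClosed {P T : Type} (N : Net P T) (Bad : Set (Set P)) : Prop :=
  ∀ M ∈ Bad, ∀ M' : Set P, N.reach M M' → M' ∈ Bad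

namespace Unfolding

variable {P T B E : Type} {N : Net P T} {M₀ : Set P} (U : Unfolding P T N M₀ B E)

/-- `Mark C = f(cut C)`. -/
def Mark (C : Set E) : Set P := U.fB '' U.occ.cut C

/-- A finite configuration is doomed iff every run extending it contains a finite
configuration (extending it) whose marking is bad. -/
def doomed (Bad : Set (Set P)) (C : Set E) : Prop :=
  ∀ ω : Set E, U.occ.run ω → C ⊆ ω →
    ∃ C' : Set E, C'.Finite ∧ U.occ.config C' ∧ C ⊆ C' ∧ C' ⊆ ω ∧ U.Mark C' ∈ Bad

/-- A configuration is free iff it is not doomed. -/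
def free (Bad : Set (Set P)) (C : Set E) : Prop := ¬ U.doomed Bad C

/-- A finite configuration is minimally doomed iff it is doomed and no proper
sub-configuration of it is doomed. -/
def minDoomed (Bad : Set (Set P)) (C : Set E) : Prop :=
  C.Finite ∧ U.occ.config C ∧ U.doomed Bad C ∧
  ∀ C' : Set E, C' ⊂ C → U.occ.config C' → ¬ U.doomed Bad C'

/-- A (finite) prefix of the unfolding: a finite, causally closed set of events. -/
def isPrefix (E' : Set E) : Prop :=
  E'.Finite ∧ ∀ e ∈ E', ∀ e' : E, U.occ.toNet.ltN (Sum.inr e') (Sum.inr e) → e' ∈ E'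

/-- A complete prefix `Π₀` of the unfolding. -/
def isCompletePrefix (E' : Set E) : Prop :=
  U.isPrefix E' ∧
  ∀ M : Set P, N.reach M₀ M →
    ∃ C : Set E, U.occ.config C ∧ C ⊆ E' ∧ U.Mark C = M ∧
      ∀ t : T, N.enabled M t → ∃ e ∈ E', U.fE e = t ∧ U.occ.enabledBy C e

/-- `isPi1 E₀ E₁`: `E₀` is a complete prefix `Π₀` and `E₁` is the prefix `Π₁`
obtained by appending, after every `⊆`-maximal configuration `Cm` of `Π₀`, a
complete prefix of the unfolding of `(N, Mark Cm)`. -/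
def isPi1 (E₀ E₁ : Set E) : Prop :=
  U.isCompletePrefix E₀ ∧ U.isPrefix E₁ ∧ E₀ ⊆ E₁ ∧
  ∀ Cm : Set E, U.occ.config Cm → Cm ⊆ E₀ →
    (∀ C' : Set E, U.occ.config C' → C' ⊆ E₀ → Cm ⊆ C' → C' = Cm) →
    ∀ M : Set P, N.reach (U.Mark Cm) M →
      ∃ C : Set E, U.occ.config C ∧ Cm ⊆ C ∧ C ⊆ E₁ ∧ U.Mark C = M ∧
        ∀ t : T, N.enabled M t → ∃ e ∈ E₁, U.fE e = t ∧ U.occ.enabledBy C e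

end Unfolding

namespace OccNet

variable {B E : Type} (O : OccNet B E)

/-- Condition `b` is consumed by some event of `C`. -/
def consumed (C : Set E) (b : B) : Prop := ∃ e ∈ C, O.toNet.pt b e

/-- Closure under the producers of the preconditions. -/
def preClosed (C : Set E) : Prop :=
  ∀ e ∈ C, ∀ b, O.toNet.pt b e → ∀ e', O.toNet.tp e' b → e' ∈ C

/-- No two distinct events of `C` share a precondition. -/
def noSharing (C : Set E) : Prop :=
  ∀ u ∈ C, ∀ v ∈ C, ∀ b, O.toNet.pt b u → O.toNet.pt b v → u = v

/-- All events producing a node (the event itself, for an event) belong to `C`. -/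
def covers (C : Set E) : B ⊕ E → Prop
  | Sum.inl b => ∀ e, O.toNet.tp e b → e ∈ C
  | Sum.inr e => e ∈ C

variable {O}

theorem preClosed.covers_of_ltN {C : Set E} (hC : O.preClosed C) {x y : B ⊕ E}
    (h : O.toNet.ltN x y) (hy : O.covers C y) : O.covers C x := by
  have key : ∀ x y, O.toNet.edge x y → O.covers C y → O.covers C x := by
    rintro (b | e) (b' | e') hxy hy
    · exact hxy.elim
    · exact fun g hg => hC e' hy b hxy g hg
    · exact hy e hxy
    · exact hxy.elim
  induction h using Relation.TransGen.head_induction_on with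
  | single h => exact key _ _ h hy
  | head h _ ih => exact key _ _ h ih

theorem preClosed.covers_of_leN {C : Set E} (hC : O.preClosed C) {x y : B ⊕ E}
    (h : O.toNet.leN x y) (hy : O.covers C y) : O.covers C x := by
  rcases h with h | rfl
  · exact hC.covers_of_ltN h hy
  · exact hy

theorem config_iff {C : Set E} : O.config C ↔ O.preClosed C ∧ O.noSharing C := by
  constructor
  · rintro ⟨h1, h2⟩
    refine ⟨fun e he b hb e' he' => h1 e he e' ?_, fun u hu v hv b hbu hbv => ?_⟩
    · exact Relation.TransGen.head (b := Sum.inl b) he' (Relation.TransGen.single hb)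
    · by_contra hne
      exact h2 u hu v hv ⟨u, v, hne, Or.inr rfl, Or.inr rfl, b, hbu, hbv⟩
  · rintro ⟨h1, h2⟩
    refine ⟨fun e he e' hlt => h1.covers_of_ltN hlt (y := Sum.inr e) he, ?_⟩
    rintro e he e' he' ⟨u, v, hne, hu, hv, b, hbu, hbv⟩
    exact hne (h2 u (h1.covers_of_leN hu (y := Sum.inr e) he) v
      (h1.covers_of_leN hv (y := Sum.inr e') he') b hbu hbv)

theorem config.preClosed {C : Set E} (h : O.config C) : O.preClosed C := (config_iff.1 h).1

theorem config.noSharing {C : Set E} (h : O.config C) : O.noSharing C := (config_iff.1 h).2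

theorem producer_unique {b : B} {e e' : E} (h : O.toNet.tp e b) (h' : O.toNet.tp e' b) :
    e = e' :=
  O.pre_subsingleton b h h'

theorem not_tp_of_mem_c₀ {b : B} {e : E} (hb : b ∈ O.c₀) : ¬ O.toNet.tp e b := fun h => by
  have h' : e ∈ O.toNet.preP b := h
  rw [(O.mem_c₀_iff b).1 hb] at h'
  exact h'

theorem covers_of_mem_cut {C : Set E} {b : B} (hb : b ∈ O.cut C) : O.covers C (Sum.inl b) := by
  intro e he
  rcases hb.1 with h0 | ⟨g, hg, hgb⟩
  · exact (not_tp_of_mem_c₀ h0 he).elim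
  · exact producer_unique hgb he ▸ hg

theorem mem_cut_of_covers {C : Set E} {b : B} (hb : O.covers C (Sum.inl b))
    (hc : ¬ O.consumed C b) : b ∈ O.cut C := by
  refine ⟨?_, hc⟩
  by_cases h : O.toNet.preP b = ∅
  · exact Or.inl ((O.mem_c₀_iff b).2 h)
  · obtain ⟨e, he⟩ := Set.nonempty_iff_ne_empty.2 h
    exact Or.inr ⟨e, hb e he, he⟩

theorem mem_cut_mono {C D : Set E} {b : B} (hCD : C ⊆ D) (hb : b ∈ O.cut C)
    (hc : ¬ O.consumed D b) : b ∈ O.cut D :=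
  mem_cut_of_covers (fun e he => hCD (covers_of_mem_cut hb e he)) hc

theorem config.coset_cut {C : Set E} (hC : O.config C) : O.toNet.coset (O.cut C) := by
  have hle : ∀ b ∈ O.cut C, ∀ b' ∈ O.cut C, b ≠ b' →
      ¬ O.toNet.leN (Sum.inl b) (Sum.inl b') := by
    rintro b hb b' hb' hne (h | h)
    · obtain ⟨y, hy, hyb⟩ := Relation.TransGen.head'_iff.1 h
      rcases y with c | e
      · exact hy.elim
      · have hle : O.toNet.leN (Sum.inr e) (Sum.inl b') := by
          rcases Relation.reflTransGen_iff_eq_or_transGen.1 hyb with h | h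
          · exact Or.inr h.symm
          · exact Or.inl h
        exact hb.2 ⟨e, hC.preClosed.covers_of_leN hle (covers_of_mem_cut hb'), hy⟩
    · exact hne (Sum.inl.inj h)
  intro b hb b' hb' hne
  refine ⟨hle b hb b' hb' hne, hle b' hb' b hb hne.symm, ?_⟩
  rintro ⟨u, v, huv, hu, hv, c, hcu, hcv⟩
  exact huv (hC.noSharing u (hC.preClosed.covers_of_leN hu (covers_of_mem_cut hb)) v
    (hC.preClosed.covers_of_leN hv (covers_of_mem_cut hb')) c hcu hcv)

theorem config.config_insert {C : Set E} (hC : O.config C) {e : E}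
    (he : O.toNet.preT e ⊆ O.cut C) : O.config (insert e C) := by
  refine config_iff.2 ⟨?_, ?_⟩
  · rintro g (rfl | hg) b hb e' he'
    · exact Or.inr (covers_of_mem_cut (he hb) e' he')
    · exact Or.inr (hC.preClosed g hg b hb e' he')
  · rintro u (rfl | hu) v (rfl | hv) b hbu hbv
    · rfl
    · exact ((he hbu).2 ⟨v, hv, hbv⟩).elim
    · exact ((he hbv).2 ⟨u, hu, hbu⟩).elim
    · exact hC.noSharing u hu v hv b hbu hbv

theorem config.cut_insert {C : Set E} (hC : O.config C) {e : E} (heC : e ∉ C) :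
    O.cut (insert e C) = (O.cut C \ O.toNet.preT e) ∪ O.toNet.postT e := by
  ext b
  constructor
  · rintro ⟨hb, hnc⟩
    have hne : ¬ O.toNet.pt b e := fun h => hnc ⟨e, Or.inl rfl, h⟩
    have hnC : ¬ O.consumed C b := fun ⟨g, hg, h⟩ => hnc ⟨g, Or.inr hg, h⟩
    rcases hb with h0 | ⟨g, rfl | hg, hgb⟩
    · exact Or.inl ⟨⟨Or.inl h0, hnC⟩, hne⟩
    · exact Or.inr hgb
    · exact Or.inl ⟨⟨Or.inr ⟨g, hg, hgb⟩, hnC⟩, hne⟩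
  · rintro (⟨hb, hne⟩ | hb)
    · refine mem_cut_mono (Set.subset_insert e C) hb ?_
      rintro ⟨g, rfl | hg, h⟩
      · exact hne h
      · exact hb.2 ⟨g, hg, h⟩
    · refine ⟨Or.inr ⟨e, Or.inl rfl, hb⟩, ?_⟩
      rintro ⟨g, rfl | hg, h⟩
      · exact O.lt_irrefl (Sum.inr g)
          (Relation.TransGen.head (b := Sum.inl b) hb (Relation.TransGen.single h))
      · exact heC (hC.preClosed g hg b h e hb)

theorem wellFounded_lt (O : OccNet B E) :
    WellFounded fun e e' : E => O.toNet.ltN (Sum.inr e) (Sum.inr e') := by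
  refine Subrelation.wf ?_
    (measure fun e : E => {x : B ⊕ E | O.toNet.leN x (Sum.inr e)}.ncard).wf
  intro e e' h
  refine Set.ncard_lt_ncard ⟨?_, fun hsub => ?_⟩ (O.finite_past e')
  · rintro x (hx | rfl)
    · exact Or.inl (Relation.TransGen.trans hx h)
    · exact Or.inl h
  · rcases hsub (show Sum.inr e' ∈ {x : B ⊕ E | O.toNet.leN x (Sum.inr e')} from Or.inr rfl)
      with h' | h'
    · exact O.lt_irrefl _ (Relation.TransGen.trans h h')
    · rw [h'] at h
      exact O.lt_irrefl _ h

theorem config.exists_extension {C D : Set E} (hD : O.config D)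
    (hCD : C ⊆ D) (hne : D ≠ C) : ∃ e ∈ D, e ∉ C ∧ O.toNet.preT e ⊆ O.cut C := by
  have hdiff : (D \ C).Nonempty := by
    rw [Set.nonempty_iff_ne_empty, Ne, Set.sdiff_eq_empty]
    exact fun h => hne (h.antisymm hCD)
  obtain ⟨e, ⟨heD, heC⟩, hmin⟩ := O.wellFounded_lt.has_min _ hdiff
  refine ⟨e, heD, heC, fun b hb => mem_cut_of_covers (fun g hg => ?_) ?_⟩
  · by_contra hgC
    exact hmin g ⟨hD.preClosed e heD b hb g hg, hgC⟩
      (Relation.TransGen.head (b := Sum.inl b) hg (Relation.TransGen.single hb))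
  · rintro ⟨g, hg, hbg⟩
    exact heC (hD.noSharing g (hCD hg) e heD b hbg hb ▸ hg)

/-- Induction along the finite configurations between `C` and `D`. -/
theorem config.grow_induction {C D : Set E} (hC : O.config C) (hD : O.config D)
    (hDfin : D.Finite) (hCD : C ⊆ D) {motive : Set E → Prop} (base : motive C)
    (step : ∀ X e, O.config X → X ⊆ D → e ∉ X → O.toNet.preT e ⊆ O.cut X →
      motive X → motive (insert e X)) : motive D := by
  have key : ∀ n : ℕ, ∀ X, O.config X → X ⊆ D → (D \ X).ncard = n → motive X → motive D := by
    intro n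
    induction n using Nat.strong_induction_on with
    | _ n ih =>
      intro X hX hXD hn hm
      by_cases hne : D = X
      · exact hne ▸ hm
      · obtain ⟨e, heD, heX, hpre⟩ := hD.exists_extension hXD hne
        refine ih _ ?_ (insert e X) (hX.config_insert hpre) (Set.insert_subset heD hXD) rfl
          (step X e hX hXD heX hpre hm)
        rw [← hn]
        refine Set.ncard_lt_ncard ⟨Set.sdiff_subset_sdiff_right (Set.subset_insert e X), ?_⟩
          (hDfin.subset Set.sdiff_subset)
        exact fun h => (h ⟨heD, heX⟩).2 (Set.mem_insert e X)
  exact key _ C hC hCD rfl base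

theorem config_empty : O.config (∅ : Set E) :=
  ⟨fun _ h => h.elim, fun _ h => h.elim⟩

theorem preT_finite (O : OccNet B E) (e : E) : (O.toNet.preT e).Finite := by
  refine ((O.finite_past e).preimage (f := Sum.inl) Sum.inl_injective.injOn).subset ?_
  exact fun b hb => Or.inl (Relation.TransGen.single hb)

/-- Inside a configuration `ω`, one can finitely extend `C` so as to consume every condition of
its cut which `ω` consumes. -/
theorem config.exists_consuming {C ω : Set E} (hω : O.config ω) (hC : O.config C)
    (hCfin : C.Finite) (hcut : (O.cut C).Finite) (hCω : C ⊆ ω) :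
    ∃ D : Set E, D.Finite ∧ O.config D ∧ C ⊆ D ∧ D ⊆ ω ∧
      ∀ b ∈ O.cut C, O.consumed ω b → O.consumed D b := by
  set K : Set E := ⋃ b ∈ O.cut C, {e | e ∈ ω ∧ O.toNet.pt b e} with hK
  have hKfin : K.Finite := hcut.biUnion fun b _ =>
    Set.Subsingleton.finite fun u hu v hv => hω.noSharing u hu.1 v hv.1 b hu.2 hv.2
  have hKω : K ⊆ ω := by
    intro e he
    simp only [hK, Set.mem_iUnion] at he
    obtain ⟨b, _, h, _⟩ := he
    exact h
  set A : Set E := ⋃ e ∈ K, {e' | O.toNet.leN (Sum.inr e') (Sum.inr e)} with hA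
  have hAω : A ⊆ ω := by
    intro e he
    simp only [hA, Set.mem_iUnion] at he
    obtain ⟨g, hg, h⟩ := he
    exact hω.preClosed.covers_of_leN h (y := Sum.inr g) (hKω hg)
  have hDω : C ∪ A ⊆ ω := Set.union_subset hCω hAω
  refine ⟨C ∪ A, hCfin.union (hKfin.biUnion fun e _ => ?_), config_iff.2 ⟨?_, ?_⟩,
    Set.subset_union_left, hDω, ?_⟩
  · exact (O.finite_past e).preimage (f := Sum.inr) Sum.inr_injective.injOn
  · rintro e (he | he) b hb e' he'
    · exact Or.inl (hC.preClosed e he b hb e' he')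
    · simp only [hA, Set.mem_iUnion] at he
      obtain ⟨g, hg, h⟩ := he
      have hlt : O.toNet.ltN (Sum.inr e') (Sum.inr e) :=
        Relation.TransGen.head (b := Sum.inl b) he' (Relation.TransGen.single hb)
      refine Or.inr (Set.mem_biUnion hg (Or.inl ?_))
      rcases h with h | h
      · exact Relation.TransGen.trans hlt h
      · exact h ▸ hlt
  · exact fun u hu v hv => hω.noSharing u (hDω hu) v (hDω hv)
  · rintro b hb ⟨e, he, hbe⟩
    exact ⟨e, Or.inr (Set.mem_biUnion (Set.mem_biUnion hb ⟨he, hbe⟩) (Or.inr rfl)), hbe⟩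

end OccNet

namespace Unfolding

open OccNet Filter

variable {P T B E : Type} {N : Net P T} {M₀ : Set P} {U : Unfolding P T N M₀ B E}

theorem enabled_of_preT_subset {C : Set E} {e : E} (he : U.occ.toNet.preT e ⊆ U.occ.cut C) :
    N.enabled (U.Mark C) (U.fE e) := by
  intro p hp
  obtain ⟨b, hb, rfl⟩ := (U.pre_bij e).surjOn hp
  exact ⟨b, he hb, rfl⟩

theorem Mark_insert {C : Set E} (hC : U.occ.config C) (hinj : Set.InjOn U.fB (U.occ.cut C))
    {e : E} (heC : e ∉ C) (he : U.occ.toNet.preT e ⊆ U.occ.cut C) :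
    U.Mark (insert e C) = N.fire (U.Mark C) (U.fE e) := by
  rw [Mark, hC.cut_insert heC, Set.image_union, hinj.image_sdiff_subset he,
    (U.pre_bij e).image_eq, (U.post_bij e).image_eq]
  rfl

theorem reach_and_injOn (hsafe : N.safe M₀) {C : Set E} (hfin : C.Finite)
    (hC : U.occ.config C) : N.reach M₀ (U.Mark C) ∧ Set.InjOn U.fB (U.occ.cut C) := by
  refine config_empty.grow_induction hC hfin (Set.empty_subset C)
    (motive := fun X => N.reach M₀ (U.Mark X) ∧ Set.InjOn U.fB (U.occ.cut X)) ?_ ?_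
  · have h0 : U.occ.cut ∅ = U.occ.c₀ := by
      ext b
      simp [cut]
    rw [Mark, h0, U.init_bij.image_eq]
    exact ⟨Relation.ReflTransGen.refl, U.init_bij.injOn⟩
  · rintro X e hX - heX hpre ⟨hr, hinj⟩
    have hen := enabled_of_preT_subset hpre
    refine ⟨hr.tail ⟨U.fE e, hen, Mark_insert hX hinj heX hpre⟩, ?_⟩
    have hmix : ∀ b ∈ U.occ.cut X \ U.occ.toNet.preT e, ∀ b' ∈ U.occ.toNet.postT e,
        U.fB b ≠ U.fB b' := by
      rintro b ⟨hb, hbe⟩ b' hb' heq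
      have hp := hsafe _ hr _ hen ⟨⟨b, hb, rfl⟩, heq ▸ (U.post_bij e).mapsTo hb'⟩
      obtain ⟨c, hc, hcb⟩ := (U.pre_bij e).surjOn hp
      exact hbe (hinj (hpre hc) hb hcb ▸ hc)
    rw [hX.cut_insert heX]
    rintro b (hb | hb) b' (hb' | hb') heq
    · exact hinj hb.1 hb'.1 heq
    · exact (hmix b hb b' hb' heq).elim
    · exact (hmix b' hb' b hb heq.symm).elim
    · exact (U.post_bij e).injOn hb hb' heq

theorem reach_of_subset (hsafe : N.safe M₀) {C D : Set E} (hC : U.occ.config C)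
    (hD : U.occ.config D) (hfin : D.Finite) (hCD : C ⊆ D) :
    N.reach (U.Mark C) (U.Mark D) := by
  refine hC.grow_induction hD hfin hCD (motive := fun X => N.reach (U.Mark C) (U.Mark X))
    Relation.ReflTransGen.refl ?_
  intro X e hX hXD heX hpre hr
  exact hr.tail ⟨U.fE e, enabled_of_preT_subset hpre,
    Mark_insert hX (reach_and_injOn hsafe (hfin.subset hXD) hX).2 heX hpre⟩

theorem cut_finite [Finite P] (hsafe : N.safe M₀) {C : Set E} (hfin : C.Finite)
    (hC : U.occ.config C) : (U.occ.cut C).Finite :=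
  Set.Finite.of_finite_image (Set.toFinite _) (reach_and_injOn hsafe hfin hC).2

/-- In a safe net, an event without preconditions has no postconditions. -/
theorem postT_eq_empty (hsafe : N.safe M₀) {e : E} (he : U.occ.toNet.preT e = ∅) :
    U.occ.toNet.postT e = ∅ := by
  have hpre : N.preT (U.fE e) = ∅ := by
    rw [← (U.pre_bij e).image_eq, he, Set.image_empty]
  have hen : ∀ M, N.enabled M (U.fE e) := fun M => by
    rw [Net.enabled, hpre]
    exact Set.empty_subset M
  refine Set.eq_empty_of_forall_notMem fun b hb => ?_
  have hp := (U.post_bij e).mapsTo hb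
  have := hsafe _ (Relation.ReflTransGen.single ⟨U.fE e, hen M₀, rfl⟩) _ (hen _)
    ⟨Or.inr hp, hp⟩
  rw [hpre] at this
  exact this

theorem exists_event_of_enabled {C : Set E} (hC : U.occ.config C)
    (hinj : Set.InjOn U.fB (U.occ.cut C)) {t : T} (ht : N.enabled (U.Mark C) t) :
    ∃ e, U.occ.toNet.preT e = {b | b ∈ U.occ.cut C ∧ U.fB b ∈ N.preT t} ∧ U.fE e = t := by
  refine U.event_exists _ t (fun b hb b' hb' => hC.coset_cut b hb.1 b' hb'.1)
    ⟨fun b hb => hb.2, fun b hb b' hb' => hinj hb.1 hb'.1, fun p hp => ?_⟩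
  obtain ⟨b, hb, rfl⟩ := ht hp
  exact ⟨b, ⟨hb, hp⟩, rfl⟩

/-- An extension of `C` can be imitated from any configuration with the same marking. -/
theorem exists_imitation (hsafe : N.safe M₀) {C D C' : Set E} (hC : U.occ.config C)
    (hD : U.occ.config D) (hDfin : D.Finite) (hCD : C ⊆ D) (hC' : U.occ.config C')
    (hC'fin : C'.Finite) (hM : U.Mark C = U.Mark C') :
    ∃ D' : Set E, D'.Finite ∧ U.occ.config D' ∧ C' ⊆ D' ∧ U.Mark D = U.Mark D' ∧
      ∀ b ∈ U.occ.cut C, U.occ.consumed D b →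
        ∀ b' ∈ U.occ.cut C', U.fB b' = U.fB b → U.occ.consumed D' b' := by
  refine hC.grow_induction hD hDfin hCD (motive := fun X =>
    ∃ D' : Set E, D'.Finite ∧ U.occ.config D' ∧ C' ⊆ D' ∧ U.Mark X = U.Mark D' ∧
      ∀ b ∈ U.occ.cut C, U.occ.consumed X b →
        ∀ b' ∈ U.occ.cut C', U.fB b' = U.fB b → U.occ.consumed D' b') ?_ ?_
  · exact ⟨C', hC'fin, hC', subset_rfl, hM, fun b hb hc => (hb.2 hc).elim⟩
  · rintro X e hX hXD heX hpre ⟨X', hfin', hX', hCX', hMX, hcons⟩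
    by_cases hemp : U.occ.toNet.preT e = ∅
    · refine ⟨X', hfin', hX', hCX', ?_, ?_⟩
      · rw [← hMX, Mark, hX.cut_insert heX, hemp, postT_eq_empty hsafe hemp, Set.sdiff_empty,
          Set.union_empty]
        rfl
      · rintro b hb ⟨g, rfl | hg, hbg⟩
        · exact (Set.notMem_empty b (hemp ▸ hbg)).elim
        · exact hcons b hb ⟨g, hg, hbg⟩
    · have hinj := (reach_and_injOn hsafe (hDfin.subset hXD) hX).2
      have hinj' := (reach_and_injOn hsafe hfin' hX').2
      have hen := enabled_of_preT_subset hpre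
      obtain ⟨e', hpre', hlab⟩ := exists_event_of_enabled hX' hinj' (hMX ▸ hen)
      have hsub : U.occ.toNet.preT e' ⊆ U.occ.cut X' := by
        rw [hpre']
        exact fun b hb => hb.1
      have heX' : e' ∉ X' := by
        intro h
        obtain ⟨b, hb⟩ := Set.nonempty_iff_ne_empty.2 hemp
        have hp := (U.pre_bij e).mapsTo hb
        rw [← hlab] at hp
        obtain ⟨c, hc, -⟩ := (U.pre_bij e').surjOn hp
        exact (hsub hc).2 ⟨e', h, hc⟩
      refine ⟨insert e' X', hfin'.insert e', hX'.config_insert hsub,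
        hCX'.trans (Set.subset_insert e' X'), ?_, ?_⟩
      · rw [Mark_insert hX hinj heX hpre, Mark_insert hX' hinj' heX' hsub, hMX, hlab]
      · intro b hb hc b' hb' heq
        by_cases hcX' : U.occ.consumed X' b'
        · obtain ⟨g, hg, h⟩ := hcX'
          exact ⟨g, Or.inr hg, h⟩
        · obtain ⟨g, rfl | hg, hbg⟩ := hc
          · refine ⟨e', Or.inl rfl, ?_⟩
            have : b' ∈ U.occ.toNet.preT e' := by
              rw [hpre']
              refine ⟨mem_cut_mono hCX' hb' hcX', ?_⟩
              rw [heq]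
              exact (U.pre_bij g).mapsTo hbg
            exact this
          · exact (hcX' (hcons b hb ⟨g, hg, hbg⟩ b' hb' heq)).elim

/-- The pairs of finite configurations with equal markings whose first component lies in `ω`. -/
structure Paired (U : Unfolding P T N M₀ B E) (ω : Set E) (s : Set E × Set E) : Prop where
  fin₁ : s.1.Finite
  config₁ : U.occ.config s.1
  subset : s.1 ⊆ ω
  fin₂ : s.2.Finite
  config₂ : U.occ.config s.2
  mark_eq : U.Mark s.1 = U.Mark s.2

theorem Paired.exists_next [Finite P] (hsafe : N.safe M₀) {ω : Set E} (hω : U.occ.config ω)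
    {s : Set E × Set E} (hs : Paired U ω s) :
    ∃ s', Paired U ω s' ∧ s.1 ⊆ s'.1 ∧ s.2 ⊆ s'.2 ∧
      ∀ b ∈ U.occ.cut s.1, U.occ.consumed ω b →
        ∀ b' ∈ U.occ.cut s.2, U.fB b' = U.fB b → U.occ.consumed s'.2 b' := by
  obtain ⟨D, hDfin, hD, hsub, hDω, hc⟩ := hω.exists_consuming hs.config₁ hs.fin₁
    (cut_finite hsafe hs.fin₁ hs.config₁) hs.subset
  obtain ⟨D', hfin', hD', hsub', hM, hc'⟩ := exists_imitation hsafe hs.config₁ hD hDfin hsub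
    hs.config₂ hs.fin₂ hs.mark_eq
  exact ⟨(D, D'), ⟨hDfin, hD, hDω, hfin', hD', hM⟩, hsub, hsub',
    fun b hb hbω => hc' b hb (hc b hb hbω)⟩

theorem exists_paired_seq [Finite P] (hsafe : N.safe M₀) {ω : Set E} (hω : U.occ.config ω)
    {s₀ : Set E × Set E} (hs₀ : Paired U ω s₀) :
    ∃ s : ℕ → Set E × Set E, s 0 = s₀ ∧ (∀ i, Paired U ω (s i)) ∧
      (∀ i, (s i).1 ⊆ (s (i + 1)).1) ∧ (∀ i, (s i).2 ⊆ (s (i + 1)).2) ∧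
      ∀ i, ∀ b ∈ U.occ.cut (s i).1, U.occ.consumed ω b →
        ∀ b' ∈ U.occ.cut (s i).2, U.fB b' = U.fB b → U.occ.consumed (s (i + 1)).2 b' := by
  have hnext : ∀ s : {s // Paired U ω s}, ∃ s' : {s // Paired U ω s},
      s.1.1 ⊆ s'.1.1 ∧ s.1.2 ⊆ s'.1.2 ∧
      ∀ b ∈ U.occ.cut s.1.1, U.occ.consumed ω b →
        ∀ b' ∈ U.occ.cut s.1.2, U.fB b' = U.fB b → U.occ.consumed s'.1.2 b' := by
    rintro ⟨s, hs⟩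
    obtain ⟨s', hs', h⟩ := hs.exists_next hsafe hω
    exact ⟨⟨s', hs'⟩, h⟩
  choose f hf using hnext
  have hsucc : ∀ i, f^[i + 1] ⟨s₀, hs₀⟩ = f (f^[i] ⟨s₀, hs₀⟩) := fun i =>
    Function.iterate_succ_apply' f i _
  refine ⟨fun i => (f^[i] ⟨s₀, hs₀⟩).1, rfl, fun i => (f^[i] ⟨s₀, hs₀⟩).2, ?_, ?_, ?_⟩
  all_goals intro i
  all_goals simp only [hsucc]
  · exact (hf _).1
  · exact (hf _).2.1
  · exact (hf _).2.2

theorem config_iUnion_union {C : ℕ → Set E} (hmono : Monotone C)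
    (hC : ∀ i, U.occ.config (C i)) :
    U.occ.config ((⋃ i, C i) ∪ {e | U.occ.toNet.preT e = ∅}) := by
  have hpre : ∀ e b, U.occ.toNet.pt b e → U.occ.toNet.preT e ≠ ∅ := fun e b hb h =>
    Set.notMem_empty b (h ▸ hb)
  refine config_iff.2 ⟨?_, ?_⟩
  · rintro e (he | he) b hb e' he'
    · obtain ⟨i, hi⟩ := Set.mem_iUnion.1 he
      exact Or.inl (Set.mem_iUnion.2 ⟨i, (hC i).preClosed e hi b hb e' he'⟩)
    · exact (hpre e b hb he).elim
  · rintro u (hu | hu) v (hv | hv) b hbu hbv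
    · obtain ⟨i, hi⟩ := Set.mem_iUnion.1 hu
      obtain ⟨j, hj⟩ := Set.mem_iUnion.1 hv
      exact (hC (max i j)).noSharing u (hmono (le_max_left i j) hi) v
        (hmono (le_max_right i j) hj) b hbu hbv
    · exact (hpre v b hbv hv).elim
    · exact (hpre u b hbu hu).elim
    · exact (hpre u b hbu hu).elim

/-- Adding events without preconditions does not change the cut. -/
theorem cut_union_eq (hsafe : N.safe M₀) {C D : Set E}
    (hD : ∀ e ∈ D, e ∈ C ∨ U.occ.toNet.preT e = ∅) : U.occ.cut (C ∪ D) = U.occ.cut C := by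
  have hpt : {b | ∃ e ∈ C ∪ D, U.occ.toNet.pt b e} = {b | ∃ e ∈ C, U.occ.toNet.pt b e} := by
    ext b
    refine ⟨?_, fun ⟨e, he, hb⟩ => ⟨e, Or.inl he, hb⟩⟩
    rintro ⟨e, he | he, hb⟩
    · exact ⟨e, he, hb⟩
    · rcases hD e he with h | h
      · exact ⟨e, h, hb⟩
      · exact (Set.notMem_empty b (h ▸ hb)).elim
  have htp : {b | ∃ e ∈ C ∪ D, U.occ.toNet.tp e b} = {b | ∃ e ∈ C, U.occ.toNet.tp e b} := by
    ext b
    refine ⟨?_, fun ⟨e, he, hb⟩ => ⟨e, Or.inl he, hb⟩⟩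
    rintro ⟨e, he | he, hb⟩
    · exact ⟨e, he, hb⟩
    · rcases hD e he with h | h
      · exact ⟨e, h, hb⟩
      · exact (Set.notMem_empty b (postT_eq_empty hsafe h ▸ hb)).elim
  rw [cut, cut, hpt, htp]

theorem run_iUnion_union (hsafe : N.safe M₀) {ω : Set E} (hω : U.occ.run ω)
    {s : ℕ → Set E × Set E} (hs : ∀ i, Paired U ω (s i)) (hmono : Monotone fun i => (s i).2)
    (hcons : ∀ i, ∀ b ∈ U.occ.cut (s i).1, U.occ.consumed ω b →
      ∀ b' ∈ U.occ.cut (s i).2, U.fB b' = U.fB b → U.occ.consumed (s (i + 1)).2 b') :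
    U.occ.run ((⋃ i, (s i).2) ∪ {e | U.occ.toNet.preT e = ∅}) := by
  refine ⟨config_iUnion_union hmono fun i => (hs i).config₂, fun D hD hsub => ?_⟩
  by_contra hne
  obtain ⟨e, heD, heω, hpre⟩ := hD.exists_extension hsub hne
  have hle : ∀ i, (s i).2 ⊆ (⋃ i, (s i).2) ∪ {e | U.occ.toNet.preT e = ∅} := fun i x hx =>
    Or.inl (Set.mem_iUnion.2 ⟨i, hx⟩)
  have hevent : ∀ b ∈ U.occ.toNet.preT e, ∀ᶠ i in atTop, b ∈ U.occ.cut (s i).2 := by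
    intro b hb
    have hnc : ∀ i, ¬ U.occ.consumed (s i).2 b := fun i ⟨g, hg, h⟩ =>
      (hpre hb).2 ⟨g, hle i hg, h⟩
    rcases (hpre hb).1 with h0 | ⟨g, hg | hg, hgb⟩
    · exact Eventually.of_forall fun i => ⟨Or.inl h0, hnc i⟩
    · obtain ⟨i, hi⟩ := Set.mem_iUnion.1 hg
      filter_upwards [eventually_ge_atTop i] with j hj
      exact ⟨Or.inr ⟨g, hmono hj hi, hgb⟩, hnc j⟩
    · exact (Set.notMem_empty b (postT_eq_empty hsafe hg ▸ hgb)).elim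
  obtain ⟨i, hi⟩ := ((Filter.eventually_all_finite (U.occ.preT_finite e)).2 hevent).exists
  have hen : N.enabled (U.Mark (s i).1) (U.fE e) :=
    (hs i).mark_eq ▸ enabled_of_preT_subset hi
  obtain ⟨e₂, hpre₂, hlab⟩ := exists_event_of_enabled (hs i).config₁
    (reach_and_injOn hsafe (hs i).fin₁ (hs i).config₁).2 hen
  have hex : ∃ b ∈ U.occ.toNet.preT e₂, U.occ.consumed ω b := by
    by_contra! hno
    have hcut : U.occ.toNet.preT e₂ ⊆ U.occ.cut ω := fun b hb =>
      mem_cut_mono (hs i).subset (hpre₂ ▸ hb : b ∈ {b | b ∈ U.occ.cut (s i).1 ∧ _}).1 (hno b hb)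
    have hmem : e₂ ∈ ω := by
      rw [← hω.2 _ (hω.1.config_insert hcut) (Set.subset_insert e₂ ω)]
      exact Set.mem_insert e₂ ω
    obtain ⟨b, hb⟩ := Set.nonempty_iff_ne_empty.2 fun h => heω (Or.inr h)
    have hp := (U.pre_bij e).mapsTo hb
    rw [← hlab] at hp
    obtain ⟨c, hc, -⟩ := (U.pre_bij e₂).surjOn hp
    exact hno c hc ⟨e₂, hmem, hc⟩
  obtain ⟨b, hb, hbω⟩ := hex
  rw [hpre₂] at hb
  obtain ⟨b', hb', heq⟩ := (U.pre_bij e).surjOn hb.2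
  obtain ⟨g, hg, h⟩ := hcons i b hb.1 hbω b' (hi b' hb') heq
  exact (hpre hb').2 ⟨g, hle _ hg, h⟩

theorem doomed_of_mark_eq [Finite P] (hsafe : N.safe M₀) {Bad : Set (Set P)}
    (hBad : ReachClosed N Bad) {C₁ C₂ : Set E} (h1fin : C₁.Finite) (h1 : U.occ.config C₁)
    (h2fin : C₂.Finite) (h2 : U.occ.config C₂) (hmark : U.Mark C₁ = U.Mark C₂)
    (hd : U.doomed Bad C₁) : U.doomed Bad C₂ := by
  intro ω hω hsub
  obtain ⟨s, hs0, hs, hm1, hm2, hcons⟩ := exists_paired_seq hsafe hω.1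
    (s₀ := (C₂, C₁)) ⟨h2fin, h2, hsub, h1fin, h1, hmark.symm⟩
  have hmono : Monotone fun i => (s i).2 := monotone_nat_of_le_succ hm2
  have hmono₁ : Monotone fun i => (s i).1 := monotone_nat_of_le_succ hm1
  have hrun := run_iUnion_union hsafe hω hs hmono hcons
  obtain ⟨C', hfin', hC', -, hC'ω, hbad⟩ := hd _ hrun fun e he =>
    Or.inl (Set.mem_iUnion.2 ⟨0, by rw [hs0]; exact he⟩)
  have hevent : ∀ e ∈ C', ∀ᶠ i in atTop, e ∈ (s i).2 ∨ U.occ.toNet.preT e = ∅ := by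
    intro e he
    rcases hC'ω he with h | h
    · obtain ⟨i, hi⟩ := Set.mem_iUnion.1 h
      filter_upwards [eventually_ge_atTop i] with j hj
      exact Or.inl (hmono hj hi)
    · exact Eventually.of_forall fun i => Or.inr h
  obtain ⟨i, hi⟩ := ((Filter.eventually_all_finite hfin').2 hevent).exists
  have hX : U.occ.config ((s i).2 ∪ C') := by
    have hsubω : (s i).2 ∪ C' ⊆ (⋃ i, (s i).2) ∪ {e | U.occ.toNet.preT e = ∅} :=
      Set.union_subset (fun e he => Or.inl (Set.mem_iUnion.2 ⟨i, he⟩)) hC'ω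
    refine config_iff.2 ⟨?_, fun u hu v hv =>
      hrun.1.noSharing u (hsubω hu) v (hsubω hv)⟩
    rintro e (he | he) b hb e' he'
    · exact Or.inl ((hs i).config₂.preClosed e he b hb e' he')
    · exact Or.inr (hC'.preClosed e he b hb e' he')
  refine ⟨(s i).1, (hs i).fin₁, (hs i).config₁, ?_, (hs i).subset, ?_⟩
  · have h0 := hmono₁ (Nat.zero_le i)
    simp only [hs0] at h0
    exact h0
  · have hr := reach_of_subset hsafe hC' hX ((hs i).fin₂.union hfin') Set.subset_union_right
    have hM : U.Mark ((s i).2 ∪ C') = U.Mark (s i).1 := by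
      rw [(hs i).mark_eq, Mark, cut_union_eq hsafe hi, Mark]
    exact hM ▸ hBad _ hbad _ hr

end Unfolding

/-- doomedness (hence freeness) depends only on the marking: two
finite configurations of the unfolding with the same marking are either both
doomed or both free. -/
theorem doomed_iff_of_mark_eq
    {P T B E : Type} [Finite P] [Finite T]
    (N : Net P T) (M₀ : Set P) (hsafe : N.safe M₀)
    (U : Unfolding P T N M₀ B E)
    (Bad : Set (Set P)) (hBad : ReachClosed N Bad)
    (C₁ C₂ : Set E) (h1fin : C₁.Finite) (h1 : U.occ.config C₁)
    (h2fin : C₂.Finite) (h2 : U.occ.config C₂)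
    (hmark : U.Mark C₁ = U.Mark C₂) :
    (U.doomed Bad C₁ ↔ U.doomed Bad C₂) ∧
    (U.free Bad C₁ ↔ U.free Bad C₂) := by
  have h : U.doomed Bad C₁ ↔ U.doomed Bad C₂ :=
    ⟨Unfolding.doomed_of_mark_eq hsafe hBad h1fin h1 h2fin h2 hmark,
      Unfolding.doomed_of_mark_eq hsafe hBad h2fin h2 h1fin h1 hmark.symm⟩
  exact ⟨h, not_congr h⟩
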